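/- arXiv:math/0608526 — 9 statements merged into one kernel-verified Lean document; each statement's English description precedes it below -/
import Mathlib

section
/- Let G be a finite group acting on E = ℝⁿ such that g • 0 = 0 for every g ∈ G and such that for every g ∈ G the map y ↦ g • y is differentiable at 0. For g ∈ G let L_g denote the Fréchet derivative at 0 of y ↦ g • y, and define F : E → E by F(y) = (1/|G|) ∑_{η ∈ G} L_η(η⁻¹ • y). Then for every γ ∈ G and every y ∈ E one has F(γ • y) = L_γ(F(y)). -/
/-- The derivatives at a common fixed point of an action compose like the group elements. -/
theorem fderiv_mul_smul_of_fixed {𝕜 E G : Type*} [NontriviallyNormedField 𝕜]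
    [NormedAddCommGroup E] [NormedSpace 𝕜 E] [Monoid G] [MulAction G E] {x : E} {g h : G}
    (hx : h • x = x) (hg : DifferentiableAt 𝕜 (fun y : E => g • y) x)
    (hh : DifferentiableAt 𝕜 (fun y : E => h • y) x) :
    fderiv 𝕜 (fun y : E => (g * h) • y) x =
      (fderiv 𝕜 (fun y : E => g • y) x).comp (fderiv 𝕜 (fun y : E => h • y) x) := by
  have hg' : HasFDerivAt (fun y : E => g • y) (fderiv 𝕜 (fun y : E => g • y) x) (h • x) := by
    rw [hx]
    exact hg.hasFDerivAt
  simp only [mul_smul]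
  exact (hg'.comp x hh.hasFDerivAt).fderiv

/-- The Bochner average `F` of a finite group action fixing `0` is
equivariant with respect to the linearized action: `F (γ • y) = L γ (F y)`. -/
theorem bochner_average_equivariant {n : ℕ} {G : Type} [Group G] [Fintype G]
    [MulAction G (EuclideanSpace ℝ (Fin n))]
    (hfix : ∀ g : G, g • (0 : EuclideanSpace ℝ (Fin n)) = 0)
    (hdiff : ∀ g : G,
      DifferentiableAt ℝ (fun y : EuclideanSpace ℝ (Fin n) => g • y) 0)
    (L : G → EuclideanSpace ℝ (Fin n) →L[ℝ] EuclideanSpace ℝ (Fin n))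
    (hL : ∀ g : G, L g = fderiv ℝ (fun y : EuclideanSpace ℝ (Fin n) => g • y) 0)
    (F : EuclideanSpace ℝ (Fin n) → EuclideanSpace ℝ (Fin n))
    (hF : ∀ y, F y = (1 / (Fintype.card G : ℝ)) • ∑ η : G, L η (η⁻¹ • y)) :
    ∀ (γ : G) (y : EuclideanSpace ℝ (Fin n)), F (γ • y) = L γ (F y) := by
  intro γ y
  have hmul (η : G) : L (γ * η) = (L γ).comp (L η) := by
    rw [hL, hL, hL]
    exact fderiv_mul_smul_of_fixed (hfix η) (hdiff γ) (hdiff η)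
  rw [hF, hF, map_smul, map_sum, ← Equiv.sum_comp (Equiv.mulLeft γ)]
  simp [hmul, smul_smul]
end

section
/- Let 1 ≤ r ≤ ∞ and let G be a finite group acting on E = ℝⁿ such that g • 0 = 0 for every g ∈ G and such that for every g ∈ G the map y ↦ g • y is C^r on E. Then there exist a G-invariant open neighborhood V of 0, a C^r map F : E → E with F(0) = 0 that restricts to a C^r diffeomorphism from V onto an open subset of E, and a group homomorphism ρ from G to the group of linear isometric automorphisms of E, such that F(g • y) = ρ(g)(F(y)) for every g ∈ G and every y ∈ V. In other words, near the fixed point 0 the action of G is C^r-conjugate to an orthogonal action. -/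
/-- Every linear action of a finite group on a finite-dimensional inner product space becomes
isometric after a linear change of coordinates. -/
theorem exists_equiv_norm_map_eq {G E : Type*} [Group G] [Fintype G] [NormedAddCommGroup E]
    [InnerProductSpace ℝ E] [FiniteDimensional ℝ E] (L : G →* (E →L[ℝ] E)) :
    ∃ T : E ≃L[ℝ] E, ∀ g v, ‖T (L g v)‖ = ‖T v‖ := by
  let A : E →ₗ[ℝ] PiLp 2 (fun _ : G => E) :=
    (WithLp.linearEquiv 2 ℝ (G → E)).symm.toLinearMap ∘ₗ
      LinearMap.pi fun g => (L g).toLinearMap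
  have hA : ∀ v g, A v g = L g v := fun v g => rfl
  have hinj : Function.Injective A := fun v w h => by
    have h1 : A v 1 = A w 1 := by rw [h]
    simpa [hA] using h1
  have hnorm : ∀ g v, ‖A (L g v)‖ = ‖A v‖ := fun g v => by
    rw [PiLp.norm_eq_of_L2, PiLp.norm_eq_of_L2]
    congr 1
    refine Fintype.sum_equiv (Equiv.mulRight g) _ _ fun x => ?_
    simp [hA, map_mul]
  let e : E ≃ₗ[ℝ] LinearMap.range A := LinearEquiv.ofInjective A hinj
  let i : LinearMap.range A ≃ₗᵢ[ℝ] E :=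
    (stdOrthonormalBasis ℝ _).equiv (stdOrthonormalBasis ℝ E) (finCongr e.finrank_eq.symm)
  refine ⟨(e.trans i.toLinearEquiv).toContinuousLinearEquiv, fun g v => ?_⟩
  change ‖i (e (L g v))‖ = ‖i (e v)‖
  rw [i.norm_map, i.norm_map]
  exact hnorm g v

/-- A linear action of a finite group on a finite-dimensional inner product space is
linearly conjugate to an orthogonal action. -/
theorem exists_equiv_conj_isometric {G E : Type*} [Group G] [Fintype G] [NormedAddCommGroup E]
    [InnerProductSpace ℝ E] [FiniteDimensional ℝ E] (L : G →* (E →L[ℝ] E)) :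
    ∃ (T : E ≃L[ℝ] E) (ρ : G →* (E ≃ₗᵢ[ℝ] E)), ∀ g v, T (L g v) = ρ g (T v) := by
  obtain ⟨T, hT⟩ := exists_equiv_norm_map_eq L
  have hinv : ∀ g v, L g (L g⁻¹ v) = v := fun g v => by
    rw [← mul_apply_eq_comp, ← map_mul]; simp
  let M : G → (E →ₗᵢ[ℝ] E) := fun g =>
    { toLinearMap := T.toLinearMap ∘ₗ (L g).toLinearMap ∘ₗ T.symm.toLinearMap
      norm_map' := fun v => (hT g (T.symm v)).trans (by simp) }
  have hM : ∀ g v, M g v = T (L g (T.symm v)) := fun g v => rfl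
  let R : G → (E ≃ₗᵢ[ℝ] E) := fun g => LinearIsometryEquiv.ofSurjective (M g) fun v =>
    ⟨M g⁻¹ v, by simp [hM, hinv]⟩
  have hR : ∀ g v, R g v = T (L g (T.symm v)) := fun g v => rfl
  let ρ : G →* (E ≃ₗᵢ[ℝ] E) :=
    { toFun := R
      map_one' := by ext v; simp [hR]
      map_mul' := fun g h => by ext v; simp [hR] }
  exact ⟨T, ρ, fun g v => by simp [ρ, hR]⟩

/-- The linearization at a fixed point of an action by differentiable maps. -/
noncomputable def fderivAction {G E : Type*} [Group G] [NormedAddCommGroup E] [NormedSpace ℝ E]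
    [MulAction G E] (hfix : ∀ g : G, g • (0 : E) = 0)
    (hd : ∀ g : G, DifferentiableAt ℝ (fun y : E => g • y) 0) : G →* (E →L[ℝ] E) where
  toFun g := fderiv ℝ (fun y : E => g • y) 0
  map_one' := by
    simp only [one_smul]
    exact fderiv_fun_id
  map_mul' g h := by
    have h1 : HasFDerivAt (fun y : E => g • y) (fderiv ℝ (fun y : E => g • y) 0) (h • (0 : E)) := by
      rw [hfix]; exact (hd g).hasFDerivAt
    have h2 := (h1.comp (0 : E) (hd h).hasFDerivAt).fderiv
    simp only [Function.comp_def, smul_smul] at h2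
    exact h2

/-- The average `y ↦ ∑ g, L g⁻¹ (g • y)`, up to a factor `card G`, of an action against a
linear representation. -/
noncomputable def averagedMap {G E : Type*} [Group G] [Fintype G] [NormedAddCommGroup E]
    [NormedSpace ℝ E] [MulAction G E] (L : G →* (E →L[ℝ] E)) (y : E) : E :=
  ∑ g : G, L g⁻¹ (g • y)

theorem averagedMap_smul {G E : Type*} [Group G] [Fintype G] [NormedAddCommGroup E]
    [NormedSpace ℝ E] [MulAction G E] (L : G →* (E →L[ℝ] E)) (h : G) (y : E) :
    averagedMap L (h • y) = L h (averagedMap L y) := by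
  unfold averagedMap
  rw [map_sum]
  refine Fintype.sum_equiv (Equiv.mulRight h) _ _ fun g => ?_
  rw [← mul_apply_eq_comp, ← map_mul]
  simp [smul_smul]

theorem hasFDerivAt_averagedMap {G E : Type*} [Group G] [Fintype G] [NormedAddCommGroup E]
    [NormedSpace ℝ E] [MulAction G E] (hfix : ∀ g : G, g • (0 : E) = 0)
    (hd : ∀ g : G, DifferentiableAt ℝ (fun y : E => g • y) 0) :
    HasFDerivAt (averagedMap (fderivAction hfix hd))
      ((Fintype.card G : ℝ) • ContinuousLinearMap.id ℝ E) 0 := by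
  have key : HasFDerivAt (averagedMap (fderivAction hfix hd))
      (∑ g : G, (fderivAction hfix hd g⁻¹).comp (fderivAction hfix hd g)) 0 :=
    HasFDerivAt.fun_sum fun g _ =>
      (fderivAction hfix hd g⁻¹).hasFDerivAt.comp (0 : E) (hd g).hasFDerivAt
  convert key using 1
  have : ∀ g : G, (fderivAction hfix hd g⁻¹).comp (fderivAction hfix hd g) =
      ContinuousLinearMap.id ℝ E := fun g => by
    change fderivAction hfix hd g⁻¹ * fderivAction hfix hd g = 1
    rw [← map_mul]; simp
  simp [this, Nat.cast_smul_eq_nsmul]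

/-- A `C^r` map with invertible derivative at `a` restricts to an open partial homeomorphism
around `a` with `C^r` inverse on its whole target. -/
theorem ContDiff.exists_openPartialHomeomorph_contDiffOn_symm {E : Type*} [NormedAddCommGroup E]
    [NormedSpace ℝ E] [CompleteSpace E] {r : WithTop ℕ∞} (hr : 1 ≤ r) {F : E → E}
    (hF : ContDiff ℝ r F) {F' : E ≃L[ℝ] E} {a : E} (hF' : HasFDerivAt F (F' : E →L[ℝ] E) a) :
    ∃ e : OpenPartialHomeomorph E E, (e : E → E) = F ∧ a ∈ e.source ∧
      ContDiffOn ℝ r e.symm e.target := by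
  have hr0 : r ≠ 0 := (zero_lt_one.trans_le hr).ne'
  let e := hF.contDiffAt.toOpenPartialHomeomorph F hF' hr0
  have ha : a ∈ e.source := hF.contDiffAt.mem_toOpenPartialHomeomorph_source hF' hr0
  let U : Set E := fderiv ℝ F ⁻¹' Set.range ((↑) : (E ≃L[ℝ] E) → E →L[ℝ] E)
  have hU : IsOpen U := ContinuousLinearEquiv.isOpen.preimage (hF.continuous_fderiv hr0)
  refine ⟨e.restr U, rfl, ?_, fun x hx => ?_⟩
  · rw [e.restr_source' U hU]
    exact ⟨ha, F', hF'.fderiv.symm⟩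
  · have hs := (e.restr U).map_target hx
    rw [e.restr_source' U hU] at hs
    obtain ⟨D, hD⟩ := hs.2
    have hd : HasFDerivAt F (D : E →L[ℝ] E) ((e.restr U).symm x) := by
      rw [hD]; exact (hF.differentiable hr0).differentiableAt.hasFDerivAt
    exact ((e.restr U).contDiffAt_symm hx hd hF.contDiffAt).contDiffWithinAt

/-- A `C^r` action of a finite group on `ℝⁿ` fixing `0` is, near `0`,
`C^r`-conjugate to an orthogonal action: there are a `G`-invariant open
neighborhood `V` of `0`, a `C^r` map `F` with `F 0 = 0` restricting to a `C^r`
diffeomorphism from `V` onto an open set, and an orthogonal representation `ρ`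
of `G` with `F (g • y) = ρ g (F y)` on `V`. -/
theorem finite_group_action_linearizable {n : ℕ} {G : Type} [Group G] [Fintype G]
    [MulAction G (EuclideanSpace ℝ (Fin n))]
    (r : ℕ∞) (hr : 1 ≤ r)
    (hfix : ∀ g : G, g • (0 : EuclideanSpace ℝ (Fin n)) = 0)
    (hsmooth : ∀ g : G,
      ContDiff ℝ r (fun y : EuclideanSpace ℝ (Fin n) => g • y)) :
    ∃ (V : Set (EuclideanSpace ℝ (Fin n)))
      (F Finv : EuclideanSpace ℝ (Fin n) → EuclideanSpace ℝ (Fin n))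
      (ρ : G →* (EuclideanSpace ℝ (Fin n) ≃ₗᵢ[ℝ] EuclideanSpace ℝ (Fin n))),
      IsOpen V ∧ (0 : EuclideanSpace ℝ (Fin n)) ∈ V ∧
      (∀ (g : G), ∀ y ∈ V, g • y ∈ V) ∧
      ContDiff ℝ r F ∧ F 0 = 0 ∧
      IsOpen (F '' V) ∧ Set.InjOn F V ∧
      ContDiffOn ℝ r Finv (F '' V) ∧ (∀ y ∈ V, Finv (F y) = y) ∧
      (∀ (g : G), ∀ y ∈ V, F (g • y) = ρ g (F y)) := by
  have hr' : (1 : WithTop ℕ∞) ≤ r := by exact_mod_cast hr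
  have hr0 : (r : WithTop ℕ∞) ≠ 0 := (zero_lt_one.trans_le hr').ne'
  have hd : ∀ g : G, DifferentiableAt ℝ (fun y : EuclideanSpace ℝ (Fin n) => g • y) 0 :=
    fun g => ((hsmooth g).differentiable hr0).differentiableAt
  obtain ⟨T, ρ, hTρ⟩ := exists_equiv_conj_isometric (fderivAction hfix hd)
  have hF : ContDiff ℝ r fun y => T (averagedMap (fderivAction hfix hd) y) :=
    T.contDiff.comp (ContDiff.sum fun g _ => (fderivAction hfix hd g⁻¹).contDiff.comp (hsmooth g))
  have hF' : HasFDerivAt (fun y => T (averagedMap (fderivAction hfix hd) y))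
      (((ContinuousLinearEquiv.smulLeft (Units.mk0 (Fintype.card G : ℝ)
        (by exact_mod_cast Fintype.card_ne_zero))).trans T :
          EuclideanSpace ℝ (Fin n) ≃L[ℝ] EuclideanSpace ℝ (Fin n)) :
        EuclideanSpace ℝ (Fin n) →L[ℝ] EuclideanSpace ℝ (Fin n)) 0 :=
    T.hasFDerivAt.comp 0 (hasFDerivAt_averagedMap hfix hd)
  obtain ⟨e, heF, h0, hsymm⟩ := hF.exists_openPartialHomeomorph_contDiffOn_symm hr' hF'
  let V : Set (EuclideanSpace ℝ (Fin n)) := ⋂ g : G, (fun y => g • y) ⁻¹' e.source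
  have hVopen : IsOpen V :=
    isOpen_iInter_of_finite fun g => e.open_source.preimage (hsmooth g).continuous
  have hVs : V ⊆ e.source := fun y hy => by simpa using Set.mem_iInter.1 hy 1
  have hVt : e '' V ⊆ e.target := Set.image_subset_iff.2 fun y hy => e.map_source (hVs hy)
  refine ⟨V, e, e.symm, ρ, hVopen, ?_, fun g y hy => ?_, heF ▸ hF, ?_,
    e.isOpen_image_of_subset_source hVopen hVs, e.injOn.mono hVs, hsymm.mono hVt,
    fun y hy => e.left_inv (hVs hy), fun g y _ => ?_⟩
  · simpa [V, hfix] using h0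
  · refine Set.mem_iInter.2 fun h => ?_
    simpa [smul_smul] using Set.mem_iInter.1 hy (h * g)
  · simp [heF, averagedMap, hfix]
  · simp only [heF, averagedMap_smul, hTρ]
end

section
/- Let E = ℝⁿ and let g : E → E be a C^1 map such that g(0) = 0, the m-fold iterate of g is the identity map for some m ≥ 1, and the Fréchet derivative of g at 0 is the identity linear map. Then g coincides with the identity on some neighborhood of 0. -/
open Filter Topology in
/-- In a complete real normed space, a periodic map that is strictly differentiable at a fixed point
with derivative the identity agrees with the identity near that point. -/
theorem HasStrictFDerivAt.eventually_eq_self_of_iterate_eq_id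
    {E : Type*} [NormedAddCommGroup E] [NormedSpace ℝ E] [CompleteSpace E]
    {g : E → E} {a : E} (hg : HasStrictFDerivAt g (ContinuousLinearMap.id ℝ E) a)
    (hga : g a = a) {m : ℕ} (hm : m ≠ 0) (hiter : g^[m] = id) :
    ∀ᶠ y in 𝓝 a, g y = y := by
  have hm' : (m : ℝ) ≠ 0 := Nat.cast_ne_zero.mpr hm
  let φ : E → E := fun y ↦ ∑ k ∈ Finset.range m, g^[k] y
  let A : E ≃L[ℝ] E := ContinuousLinearEquiv.smulLeft (Units.mk0 (m : ℝ) hm')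
  have hφ : HasStrictFDerivAt φ (A : E →L[ℝ] E) a := by
    have h := HasStrictFDerivAt.fun_sum (u := Finset.range m) fun k _ ↦ hg.iterate hga k
    convert h using 1
    ext v
    have hpow (k : ℕ) : ContinuousLinearMap.id ℝ E ^ k = 1 := one_pow k
    simp [A, hpow, Units.smul_def, Nat.cast_smul_eq_nsmul]
  have hφg (y : E) : φ (g y) = φ y := by
    have h := (Finset.sum_range_succ' (fun k ↦ g^[k] y) m).symm.trans
      (Finset.sum_range_succ (fun k ↦ g^[k] y) m)
    simpa [φ, hiter] using h
  have hleft := hφ.eventually_left_inverse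
  have hgt : Tendsto g (𝓝 a) (𝓝 a) := by simpa only [hga] using hg.continuousAt.tendsto
  filter_upwards [hleft, hgt.eventually hleft] with y hy hgy
  rw [← hgy, hφg, hy]

/-- A finite-order `C^1` map of `ℝⁿ` fixing `0` whose derivative at
`0` is the identity is the identity near `0`. -/
theorem finite_order_map_with_identity_linearization_is_identity_near_zero
    {n : ℕ} (g : EuclideanSpace ℝ (Fin n) → EuclideanSpace ℝ (Fin n))
    (hg : ContDiff ℝ 1 g) (hg0 : g 0 = 0)
    (m : ℕ) (hm : 1 ≤ m) (hiter : g^[m] = id)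
    (hderiv : fderiv ℝ g 0 = ContinuousLinearMap.id ℝ (EuclideanSpace ℝ (Fin n))) :
    ∃ U : Set (EuclideanSpace ℝ (Fin n)),
      IsOpen U ∧ (0 : EuclideanSpace ℝ (Fin n)) ∈ U ∧ ∀ y ∈ U, g y = y := by
  have hstrict := hg.contDiffAt.hasStrictFDerivAt (x := 0) one_ne_zero
  rw [hderiv] at hstrict
  obtain ⟨U, hU, hUo, h0⟩ := eventually_nhds_iff.mp
    (hstrict.eventually_eq_self_of_iterate_eq_id hg0 (Nat.one_le_iff_ne_zero.mp hm) hiter)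
  exact ⟨U, hUo, h0, hU⟩
end

section
/- Let 1 ≤ r ≤ ∞ and let G be a finite group acting on E = ℝⁿ such that g • 0 = 0 for every g ∈ G and such that for every g ∈ G the map y ↦ g • y is C^r on E. Let Fix = { y ∈ E : g • y = y for all g ∈ G } be the common fixed-point set. Then there exist an open neighborhood V of 0, a linear subspace W of E, and a C^r map F : E → E with F(0) = 0 restricting to a C^r diffeomorphism from V onto an open subset of E, such that for every y ∈ V one has y ∈ Fix if and only if F(y) ∈ W. In particular, near 0 the fixed-point set Fix is a C^r submanifold of E. -/
/-- The average `|G|⁻¹ ∑ g, (D g (0))⁻¹ (g • y)`, which intertwines the action of `G` with the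
linear action given by the derivatives at `0`. -/
noncomputable def averagedAction {E : Type*} (G : Type*) [NormedAddCommGroup E] [NormedSpace ℝ E]
    [Group G] [Fintype G] [MulAction G E] (y : E) : E :=
  (Fintype.card G : ℝ)⁻¹ • ∑ g : G, fderiv ℝ (fun z : E => g⁻¹ • z) 0 (g • y)

section averagedAction

variable {E G : Type*} [NormedAddCommGroup E] [NormedSpace ℝ E] [Group G] [MulAction G E]

theorem fderiv_mul_smul_zero (hfix : ∀ g : G, g • (0 : E) = 0)
    (hd : ∀ g : G, Differentiable ℝ (fun y : E => g • y)) (g h : G) (v : E) :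
    fderiv ℝ (fun y : E => (g * h) • y) 0 v =
      fderiv ℝ (fun y : E => g • y) 0 (fderiv ℝ (fun y : E => h • y) 0 v) := by
  have hg : HasFDerivAt (fun y : E => g • y) (fderiv ℝ (fun y : E => g • y) 0) (h • (0 : E)) := by
    rw [hfix h]
    exact (hd g 0).hasFDerivAt
  have hgh := hg.comp (0 : E) (hd h 0).hasFDerivAt
  have heq : (fun y : E => (g * h) • y) = (fun y : E => g • y) ∘ fun y : E => h • y := by
    ext y
    exact mul_smul g h y
  rw [heq, hgh.fderiv]
  rfl

variable [Fintype G]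

theorem averagedAction_zero (hfix : ∀ g : G, g • (0 : E) = 0) :
    averagedAction G (0 : E) = 0 := by
  simp [averagedAction, hfix]

theorem averagedAction_smul (hfix : ∀ g : G, g • (0 : E) = 0)
    (hd : ∀ g : G, Differentiable ℝ (fun y : E => g • y)) (h : G) (y : E) :
    averagedAction G (h • y) = fderiv ℝ (fun z : E => h • z) 0 (averagedAction G y) := by
  simp only [averagedAction, map_smul, map_sum]
  congr 1
  refine Fintype.sum_equiv (Equiv.mulRight h) _ _ fun g => ?_
  rw [← fderiv_mul_smul_zero hfix hd]
  simp [mul_smul]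

theorem contDiff_averagedAction {r : WithTop ℕ∞}
    (hsmooth : ∀ g : G, ContDiff ℝ r (fun y : E => g • y)) :
    ContDiff ℝ r (averagedAction G : E → E) := by
  unfold averagedAction
  exact (ContDiff.sum fun g _ =>
    (ContinuousLinearMap.contDiff _).comp (hsmooth g)).const_smul _

theorem hasFDerivAt_averagedAction_zero (hfix : ∀ g : G, g • (0 : E) = 0)
    (hd : ∀ g : G, Differentiable ℝ (fun y : E => g • y)) :
    HasFDerivAt (averagedAction G : E → E) (ContinuousLinearMap.id ℝ E) 0 := by
  have hsum := (HasFDerivAt.fun_sum (u := Finset.univ) fun (g : G) _ =>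
    (fderiv ℝ (fun z : E => g⁻¹ • z) 0).hasFDerivAt.comp (0 : E)
      (hd g 0).hasFDerivAt).const_smul (Fintype.card G : ℝ)⁻¹
  refine hsum.congr_fderiv ?_
  ext v
  have hcard : (Fintype.card G : ℝ) ≠ 0 := by simp
  simp [← fderiv_mul_smul_zero hfix hd, ← Nat.cast_smul_eq_nsmul ℝ, smul_smul, hcard]

end averagedAction


/-- For a `C^r` action of a finite group on `ℝⁿ` fixing `0`, the
common fixed-point set is, near `0`, carried by a `C^r` diffeomorphism onto a
linear subspace: it is a `C^r` submanifold near `0`. -/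
theorem fixed_point_set_is_submanifold_near_zero {n : ℕ} {G : Type}
    [Group G] [Fintype G] [MulAction G (EuclideanSpace ℝ (Fin n))]
    (r : ℕ∞) (hr : 1 ≤ r)
    (hfix : ∀ g : G, g • (0 : EuclideanSpace ℝ (Fin n)) = 0)
    (hsmooth : ∀ g : G,
      ContDiff ℝ r (fun y : EuclideanSpace ℝ (Fin n) => g • y)) :
    ∃ (V : Set (EuclideanSpace ℝ (Fin n)))
      (W : Submodule ℝ (EuclideanSpace ℝ (Fin n)))
      (F Finv : EuclideanSpace ℝ (Fin n) → EuclideanSpace ℝ (Fin n)),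
      IsOpen V ∧ (0 : EuclideanSpace ℝ (Fin n)) ∈ V ∧
      ContDiff ℝ r F ∧ F 0 = 0 ∧
      IsOpen (F '' V) ∧ Set.InjOn F V ∧
      ContDiffOn ℝ r Finv (F '' V) ∧ (∀ y ∈ V, Finv (F y) = y) ∧
      (∀ y ∈ V, (y ∈ {z : EuclideanSpace ℝ (Fin n) | ∀ g : G, g • z = z}
        ↔ F y ∈ (W : Set (EuclideanSpace ℝ (Fin n))))) := by
  have hr1 : (1 : WithTop ℕ∞) ≤ r := by exact_mod_cast hr
  have hr0 : (r : WithTop ℕ∞) ≠ 0 := (zero_lt_one.trans_le hr1).ne'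
  let E := EuclideanSpace ℝ (Fin n)
  have hd (g : G) : Differentiable ℝ (fun y : E => g • y) := (hsmooth g).differentiable hr0
  let F : E → E := averagedAction G
  have hF : ContDiff ℝ r F := contDiff_averagedAction hsmooth
  have hF0 : F 0 = 0 := averagedAction_zero hfix
  have hF' : HasFDerivAt F ((ContinuousLinearEquiv.refl ℝ E : E ≃L[ℝ] E) : E →L[ℝ] E) 0 :=
    hasFDerivAt_averagedAction_zero hfix hd
  let e : OpenPartialHomeomorph E E := hF.contDiffAt.toOpenPartialHomeomorph F hF' hr0
  have he0 : (0 : E) ∈ e.source := hF.contDiffAt.mem_toOpenPartialHomeomorph_source hF' hr0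
  let I : Set E := fderiv ℝ F ⁻¹' Set.range ((↑) : (E ≃L[ℝ] E) → E →L[ℝ] E)
  let V : Set E := (e.source ∩ I) ∩ ⋂ h : G, (fun y : E => h • y) ⁻¹' e.source
  have hVe : V ⊆ e.source := fun y hy => hy.1.1
  have hVopen : IsOpen V := by
    refine (e.open_source.inter ?_).inter (isOpen_iInter_of_finite fun h => ?_)
    · exact ContinuousLinearEquiv.isOpen.preimage (hF.continuous_fderiv hr0)
    · exact e.open_source.preimage (hsmooth h).continuous
  let W : Submodule ℝ E := ⨅ h : G, LinearMap.eqLocus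
    (fderiv ℝ (fun z : E => h • z) 0 : E →ₗ[ℝ] E) LinearMap.id
  have hW (v : E) : v ∈ W ↔ ∀ h : G, fderiv ℝ (fun z : E => h • z) 0 v = v := by
    simp [W]
  refine ⟨V, W, F, e.symm, hVopen, ?_, hF, hF0, e.isOpen_image_of_subset_source hVopen hVe,
    e.injOn.mono hVe, ?_, fun y hy => e.left_inv (hVe hy), fun y hy => ?_⟩
  · exact ⟨⟨he0, ContinuousLinearEquiv.refl ℝ E, hF'.fderiv.symm⟩,
      Set.mem_iInter.2 fun h => by simpa [hfix h] using he0⟩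
  · rintro _ ⟨y, hy, rfl⟩
    obtain ⟨L, hL⟩ := hy.1.2
    have hsymm : e.symm (F y) = y := e.left_inv (hVe hy)
    refine (e.contDiffAt_symm (f₀' := L) (e.map_source (hVe hy)) ?_ ?_).contDiffWithinAt
    · change HasFDerivAt F (L : E →L[ℝ] E) (e.symm (F y))
      rw [hsymm, hL]
      exact (hF.differentiable hr0 y).hasFDerivAt
    · exact hF.contDiffAt
  · simp only [Set.mem_ofPred_eq, SetLike.mem_coe, hW]
    refine forall_congr' fun h => ?_
    change h • y = y ↔ fderiv ℝ (fun z : E => h • z) 0 (averagedAction G y) = averagedAction G y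
    rw [← averagedAction_smul hfix hd]
    exact (e.injOn.eq_iff (Set.mem_iInter.1 hy.2 h) (hVe hy)).symm
end

section
/- Let E = ℝⁿ, let 0 ≤ ε < 1, and let f : E → E be a map that is continuous on the closed unit ball and satisfies ‖f(x) − x‖ ≤ ε for every x in the closed unit ball centered at 0. Then the open ball of radius 1 − ε centered at 0 is contained in the image under f of the closed unit ball. -/
section

open Set Metric MeasureTheory
open scoped NNReal

section LinearAlgebra

open Polynomial in
/-- Lagrange interpolation for the polynomial `t ↦ det (1 + t M)`. -/
lemma Matrix.det_one_add_smul_eq_sum_basis {m ι : Type*} [Fintype m] [DecidableEq m]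
    [DecidableEq ι] {s : Finset ι} {v : ι → ℝ} (hv : Set.InjOn v s)
    (hs : Fintype.card m < s.card) (M : Matrix m m ℝ) (t : ℝ) :
    (1 + t • M).det =
      ∑ i ∈ s, (Lagrange.basis s v i).eval t * (1 + v i • M).det := by
  set p : ℝ[X] := ((X : ℝ[X]) • M.map C + (1 : Matrix m m ℝ).map C).det
  have hp : ∀ r, p.eval r = (1 + r • M).det := fun r ↦ by
    simp only [p]
    rw [← Polynomial.coe_evalRingHom, RingHom.map_det, add_comm]
    congr 1
    ext i j
    simp [Matrix.one_apply, apply_ite, mul_comm r]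
  have hdeg : p.degree < s.card :=
    (degree_le_natDegree.trans
      (Nat.cast_le.2 (natDegree_det_X_add_C_le M 1))).trans_lt (Nat.cast_lt.2 hs)
  rw [← hp, Lagrange.eq_interpolate hv hdeg, Lagrange.interpolate_apply, eval_finsetSum]
  simp [hp, mul_comm]

/-- Lagrange interpolation for the polynomial `t ↦ det (1 + t A)`. -/
lemma ContinuousLinearMap.det_one_add_smul_eq_sum_basis {E ι : Type*} [NormedAddCommGroup E]
    [NormedSpace ℝ E] [FiniteDimensional ℝ E] [DecidableEq ι] {s : Finset ι} {v : ι → ℝ}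
    (hv : Set.InjOn v s) (hs : Module.finrank ℝ E < s.card) (A : E →L[ℝ] E) (t : ℝ) :
    (1 + t • A).det = ∑ i ∈ s, (Lagrange.basis s v i).eval t * (1 + v i • A).det := by
  have key : ∀ r : ℝ, (1 + r • A).det =
      (1 + r • LinearMap.toMatrix (Module.finBasis ℝ E) (Module.finBasis ℝ E) A).det := by
    intro r
    rw [ContinuousLinearMap.det, ← LinearMap.det_toMatrix (Module.finBasis ℝ E)]
    congr 1
    simp [LinearMap.toMatrix_one]
  simp only [key]
  exact Matrix.det_one_add_smul_eq_sum_basis hv (by simpa using hs) _ t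

end LinearAlgebra

section Perturbation

variable {E : Type*} [NormedAddCommGroup E] [NormedSpace ℝ E]

/-- A Lipschitz map on the unit ball vanishing on the sphere stays Lipschitz when extended by zero. -/
lemma LipschitzOnWith.indicator_closedBall {F : Type*} [NormedAddCommGroup F] {h : E → F} {C : ℝ≥0}
    (hL : LipschitzOnWith C h (closedBall 0 1)) (h0 : ∀ x ∈ sphere (0 : E) 1, h x = 0) :
    LipschitzWith C ((closedBall 0 1).indicator h) := by
  have mixed : ∀ x ∈ closedBall (0 : E) 1, ∀ y ∉ closedBall (0 : E) 1,
      dist (h x) 0 ≤ C * dist x y := by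
    intro x hx y hy
    obtain ⟨z, hz, hz1⟩ : (1 : ℝ) ∈ (fun z : E ↦ ‖z‖) '' segment ℝ x y :=
      (convex_segment x y).isPreconnected.intermediate_value (left_mem_segment ℝ x y)
        (right_mem_segment ℝ x y) continuous_norm.continuousOn
        ⟨by simpa using hx, by simpa using (not_le.1 (by simpa using hy)).le⟩
    have hzs : z ∈ sphere (0 : E) 1 := by simpa using hz1
    rw [← h0 z hzs]
    refine (hL.dist_le_mul x hx z (sphere_subset_closedBall hzs)).trans ?_
    gcongr
    linarith [dist_add_dist_of_mem_segment hz, dist_nonneg (x := z) (y := y)]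
  refine LipschitzWith.of_dist_le_mul fun x y ↦ ?_
  by_cases hx : x ∈ closedBall (0 : E) 1 <;> by_cases hy : y ∈ closedBall (0 : E) 1
  · simpa [indicator_of_mem, hx, hy] using hL.dist_le_mul x hx y hy
  · rw [indicator_of_mem hx, indicator_of_notMem hy]
    exact mixed x hx y hy
  · rw [indicator_of_mem hy, indicator_of_notMem hx, dist_comm, dist_comm x]
    exact mixed y hy x hx
  · rw [indicator_of_notMem hx, indicator_of_notMem hy, dist_self]
    positivity

/-- A contracting perturbation of the identity which vanishes on the sphere permutes the unit ball. -/
lemma bijOn_closedBall_add_of_lipschitzOnWith [CompleteSpace E] {h : E → E} {C : ℝ≥0} (hC : C < 1)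
    (hL : LipschitzOnWith C h (closedBall 0 1)) (h0 : ∀ x ∈ sphere (0 : E) 1, h x = 0) :
    BijOn (fun x ↦ x + h x) (closedBall 0 1) (closedBall 0 1) := by
  set k : E → E := (closedBall 0 1).indicator h with hk
  have kL : LipschitzWith C k := hL.indicator_closedBall h0
  have kin : ∀ x ∈ closedBall (0 : E) 1, k x = h x := fun x hx ↦ indicator_of_mem hx h
  have kout : ∀ x ∉ closedBall (0 : E) 1, k x = 0 := fun x hx ↦ indicator_of_notMem hx h
  have inj : ∀ x y, x + k x = y + k y → x = y := by
    intro x y hxy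
    have h1 : dist x y = dist (k x) (k y) := by
      rw [dist_eq_norm, dist_eq_norm, ← norm_neg (k x - k y)]
      congr 1
      rw [neg_sub, sub_eq_sub_iff_add_eq_add, hxy, add_comm]
    have h2 := kL.dist_le_mul x y
    have h3 : (C : ℝ) < 1 := hC
    rw [← dist_le_zero]
    nlinarith [dist_nonneg (x := x) (y := y)]
  refine ⟨fun x hx ↦ ?_, fun x hx y hy hxy ↦ ?_, fun y hy ↦ ?_⟩
  · by_contra hnot
    have : x + k x = x := (inj _ _ (by
      rw [kin x hx]
      simp [kout _ hnot])).symm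
    simp only [← kin x hx, this] at hnot
    exact hnot hx
  · exact inj x y (by simpa [kin x hx, kin y hy] using hxy)
  · have hc : ContractingWith C (fun x ↦ y - k x) :=
      ⟨by exact_mod_cast hC, by simpa using (LipschitzWith.const y).sub kL⟩
    have hfix : y - k hc.fixedPoint = hc.fixedPoint := hc.fixedPoint_isFixedPt
    have hmem : hc.fixedPoint ∈ closedBall (0 : E) 1 := by
      by_contra hnot
      rw [kout _ hnot, sub_zero] at hfix
      exact hnot (hfix ▸ hy)
    refine ⟨hc.fixedPoint, hmem, ?_⟩
    simp only
    rw [← kin _ hmem]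
    nth_rewrite 1 [← hfix]
    abel

end Perturbation

section FixedPoint

variable {E : Type*} [NormedAddCommGroup E] [InnerProductSpace ℝ E] [FiniteDimensional ℝ E]

/-- The Jacobian of a map taking values in the unit sphere vanishes. -/
lemma det_fderiv_eq_zero_of_norm_eq_one {r : E → E} {x : E} (hr : DifferentiableAt ℝ r x)
    (h1 : ∀ᶠ y in nhds x, ‖r y‖ = 1) : (fderiv ℝ r x).det = 0 := by
  by_contra hdet
  have hsurj : Function.Surjective (fderiv ℝ r x) :=
    ((LinearMap.isUnit_iff_isUnit_det _).2 (isUnit_iff_ne_zero.2 hdet) |>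
      (Module.End.isUnit_iff _).1).2
  obtain ⟨v, hv⟩ := hsurj (r x)
  have hd : HasFDerivAt (fun y ↦ ‖r y‖ ^ 2) (2 • (innerSL ℝ (r x)).comp (fderiv ℝ r x)) x :=
    hr.hasFDerivAt.norm_sq
  have hd' : HasFDerivAt (fun y ↦ ‖r y‖ ^ 2) (0 : E →L[ℝ] ℝ) x :=
    (hasFDerivAt_const (1 : ℝ) x).congr_of_eventuallyEq (h1.mono fun y hy ↦ by simp [hy])
  have := congrArg (fun L : E →L[ℝ] ℝ ↦ L v) (hd.unique hd')
  simp [hv, h1.self_of_nhds] at this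

/-- If `h` vanishes on the unit sphere, the integral of the Jacobian of `x ↦ x + t • h x` over the unit
ball does not depend on `t`. -/
lemma setIntegral_det_one_add_smul_fderiv [MeasurableSpace E] [BorelSpace E] {h : E → E} {U : Set E} (hU : IsOpen U)
    (hBU : closedBall 0 1 ⊆ U) (hh : ContDiffOn ℝ 1 h U) (h0 : ∀ x ∈ sphere (0 : E) 1, h x = 0)
    (t : ℝ) :
    ∫ x in closedBall (0 : E) 1, (1 + t • fderiv ℝ h x).det = volume.real (closedBall (0 : E) 1) := by
  classical
  set B := closedBall (0 : E) 1
  have hB : IsCompact B := isCompact_closedBall 0 1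
  have hcont : ContinuousOn (fderiv ℝ h) B := (hh.continuousOn_fderiv_of_isOpen hU le_rfl).mono hBU
  have hdiff : ∀ x ∈ B, HasFDerivAt h (fderiv ℝ h x) x := fun x hx ↦
    ((hh.differentiableOn one_ne_zero).differentiableAt (hU.mem_nhds (hBU hx))).hasFDerivAt
  have hdetc : Continuous fun A : E →L[ℝ] E ↦ A.det := ContinuousLinearMap.continuous_det
  have hint : ∀ s : ℝ, IntegrableOn (fun x ↦ (1 + s • fderiv ℝ h x).det) B := fun s ↦
    (hdetc.comp_continuousOn
      (continuousOn_const.add (hcont.const_smul s))).integrableOn_compact hB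
  obtain ⟨C, hC⟩ := hB.exists_bound_of_continuousOn hcont
  have hC0 : 0 ≤ C := (norm_nonneg _).trans (hC 0 (by simp [B]))
  obtain ⟨η, hη, hdet⟩ : ∃ η > 0, ∀ A : E →L[ℝ] E, ‖A‖ < η → 0 < (1 + A).det := by
    have : ∀ᶠ A : E →L[ℝ] E in nhds 0, 0 < (1 + A).det := by
      have hc : Continuous fun A : E →L[ℝ] E ↦ (1 + A).det := hdetc.comp (by fun_prop)
      refine hc.continuousAt.eventually (lt_mem_nhds ?_)
      simp [ContinuousLinearMap.det]
    obtain ⟨η, hη, hη'⟩ := Metric.eventually_nhds_iff.1 this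
    exact ⟨η, hη, fun A hA ↦ hη' (by simpa using hA)⟩
  have small : ∀ s : ℝ, 0 ≤ s → s * C < η → s * C < 1 →
      ∫ x in B, (1 + s • fderiv ℝ h x).det = volume.real B := by
    intro s hs hsη hs1
    have hL : LipschitzOnWith (⟨s, hs⟩ * ⟨C, hC0⟩ : ℝ≥0) (fun x ↦ s • h x) B := by
      refine (convex_closedBall 0 1).lipschitzOnWith_of_nnnorm_hasFDerivWithin_le
        (f' := fun x ↦ s • fderiv ℝ h x)
        (fun x hx ↦ ((hdiff x hx).const_smul s).hasFDerivWithinAt) fun x hx ↦ ?_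
      rw [← NNReal.coe_le_coe]
      simp only [coe_nnnorm, norm_smul, Real.norm_of_nonneg hs]
      exact mul_le_mul_of_nonneg_left (hC x hx) hs
    have hbij := bijOn_closedBall_add_of_lipschitzOnWith (by exact_mod_cast hs1) hL
      fun x hx ↦ by simp [h0 x hx]
    have hcv := integral_image_eq_integral_abs_det_fderiv_smul volume measurableSet_closedBall
      (f' := fun x ↦ 1 + s • fderiv ℝ h x)
      (fun x hx ↦ ((hasFDerivAt_id x).add ((hdiff x hx).const_smul s)).hasFDerivWithinAt)
      hbij.injOn fun _ ↦ (1 : ℝ)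
    have him : (id + s • h) '' B = B := hbij.image_eq
    rw [him] at hcv
    rw [setIntegral_const, smul_eq_mul, mul_one] at hcv
    rw [hcv]
    refine setIntegral_congr_fun measurableSet_closedBall fun x hx ↦ ?_
    rw [abs_of_pos, smul_eq_mul, mul_one]
    refine hdet _ ?_
    rw [norm_smul, Real.norm_of_nonneg hs]
    exact (mul_le_mul_of_nonneg_left (hC x hx) hs).trans_lt hsη
  obtain ⟨δ, hδ, hδη, hδ1⟩ : ∃ δ > 0, δ * C < η ∧ δ * C < 1 := by
    refine ⟨min η 1 / (C + 1), by positivity, ?_, ?_⟩ <;>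
    · rw [div_mul_eq_mul_div, div_lt_iff₀ (by positivity)]
      nlinarith [min_le_left η 1, min_le_right η 1, lt_min hη one_pos]
  set S := Finset.range (Module.finrank ℝ E + 1)
  set v : ℕ → ℝ := fun i ↦ δ / (i + 1)
  have hv : Set.InjOn v S := by
    intro i _ j _ hij
    have : (i : ℝ) + 1 = j + 1 := by
      have := hij
      simp only [v] at this
      field_simp at this
      linarith
    exact_mod_cast add_right_cancel this
  have hvle : ∀ i, v i ≤ δ := fun i ↦ div_le_self hδ.le (by simp)
  have hv0 : ∀ i, 0 ≤ v i := fun i ↦ by positivity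
  have hS : Module.finrank ℝ E < S.card := by simp [S]
  simp_rw [ContinuousLinearMap.det_one_add_smul_eq_sum_basis hv hS _ t]
  rw [integral_finsetSum _ fun i _ ↦ (hint (v i)).const_mul _]
  have hnode : ∀ i, ∫ x in B, (1 + v i • fderiv ℝ h x).det = volume.real B := fun i ↦
    small _ (hv0 i) ((mul_le_mul_of_nonneg_right (hvle i) hC0).trans_lt hδη)
      ((mul_le_mul_of_nonneg_right (hvle i) hC0).trans_lt hδ1)
  simp_rw [integral_const_mul, hnode, ← Finset.sum_mul, ← Polynomial.eval_finsetSum]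
  rw [Lagrange.sum_basis hv ⟨0, by simp [S]⟩, Polynomial.eval_one, one_mul]

/-- There is no `C¹` retraction of the closed unit ball onto its boundary. -/
theorem false_of_contDiffOn_retraction_sphere {r : E → E} {U : Set E} (hU : IsOpen U)
    (hBU : closedBall 0 1 ⊆ U) (hr : ContDiffOn ℝ 1 r U) (hr1 : ∀ x ∈ U, ‖r x‖ = 1)
    (hrid : ∀ x ∈ sphere (0 : E) 1, r x = x) : False := by
  borelize E
  have hint := setIntegral_det_one_add_smul_fderiv hU hBU (hr.sub contDiffOn_id)
    (fun x hx ↦ by simp [hrid x hx]) 1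
  have hdr : ∀ x ∈ closedBall (0 : E) 1, DifferentiableAt ℝ r x := fun x hx ↦
    (hr.differentiableOn one_ne_zero).differentiableAt (hU.mem_nhds (hBU hx))
  rw [setIntegral_congr_fun (g := fun _ ↦ (0 : ℝ)) measurableSet_closedBall fun x hx ↦ ?_] at hint
  · have : 0 < volume.real (closedBall (0 : E) 1) :=
      ENNReal.toReal_pos (measure_closedBall_pos _ _ one_pos).ne' measure_closedBall_lt_top.ne
    simp at hint
    linarith
  · have : fderiv ℝ (r - id) x = fderiv ℝ r x - 1 := by
      rw [fderiv_sub (hdr x hx) differentiableAt_id, fderiv_id]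
      rfl
    change (1 + (1 : ℝ) • fderiv ℝ (r - id) x).det = 0
    rw [this, one_smul, add_sub_cancel]
    exact det_fderiv_eq_zero_of_norm_eq_one (hdr x hx)
      ((hU.mem_nhds (hBU hx)) |> fun h ↦ Filter.mem_of_superset h hr1)


/-- A `C¹` map sending the closed unit ball to the open unit ball has a fixed point. -/
theorem exists_fixedPoint_closedBall_of_contDiff {p : E → E} (hp : ContDiff ℝ 1 p)
    (hp1 : ∀ x ∈ closedBall (0 : E) 1, ‖p x‖ < 1) : ∃ x ∈ closedBall (0 : E) 1, p x = x := by
  by_contra! hne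
  set u : E → E := fun x ↦ x - p x
  set D : E → ℝ := fun x ↦ inner ℝ x (u x) ^ 2 + ‖u x‖ ^ 2 * (1 - ‖x‖ ^ 2)
  have hu : ContDiff ℝ 1 u := contDiff_id.sub hp
  have hD : ContDiff ℝ 1 D :=
    ((contDiff_id.inner ℝ hu).pow 2).add
      ((hu.norm_sq ℝ).mul (contDiff_const.sub (contDiff_id.norm_sq ℝ)))
  have inner_pos : ∀ x ∈ sphere (0 : E) 1, 0 < inner ℝ x (u x) := by
    intro x hx
    have hx1 : ‖x‖ = 1 := by simpa using hx
    have h1 := real_inner_le_norm x (p x)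
    have h2 := hp1 x (sphere_subset_closedBall hx)
    rw [hx1, one_mul] at h1
    simp only [u, inner_sub_right, real_inner_self_eq_norm_sq, hx1]
    linarith
  set U : Set E := {x | u x ≠ 0} ∩ {x | 0 < D x}
  have hU : IsOpen U :=
    (isOpen_ne_fun hu.continuous continuous_const).inter
      (isOpen_lt continuous_const hD.continuous)
  have hBU : closedBall 0 1 ⊆ U := by
    intro x hx
    have hux : u x ≠ 0 := sub_ne_zero.2 (hne x hx).symm
    refine ⟨hux, ?_⟩
    change 0 < inner ℝ x (u x) ^ 2 + ‖u x‖ ^ 2 * (1 - ‖x‖ ^ 2)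
    have hu0 := norm_pos_iff.2 hux
    rcases (mem_closedBall_zero_iff.1 hx).lt_or_eq with hlt | heq
    · have : 0 < 1 - ‖x‖ ^ 2 := by nlinarith [norm_nonneg x]
      positivity
    · have := inner_pos x (by simpa using heq)
      rw [heq]
      simpa using pow_pos this 2
  refine false_of_contDiffOn_retraction_sphere hU hBU
    (r := fun x ↦ x + ((-inner ℝ x (u x) + √(D x)) / ‖u x‖ ^ 2) • u x) ?_ ?_ ?_
  · refine contDiffOn_id.add (ContDiffOn.smul (ContDiffOn.div ?_ ?_ ?_) hu.contDiffOn)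
    · exact (contDiff_id.inner ℝ hu).neg.contDiffOn.add
        (hD.contDiffOn.sqrt fun x hx ↦ hx.2.ne')
    · exact (hu.norm_sq ℝ).contDiffOn
    · exact fun x hx ↦ pow_ne_zero 2 (norm_ne_zero_iff.2 hx.1)
  · rintro x ⟨hux, hDx⟩
    have ha : ‖u x‖ ^ 2 ≠ 0 := pow_ne_zero 2 (norm_ne_zero_iff.2 hux)
    have hsq : √(D x) ^ 2 = inner ℝ x (u x) ^ 2 + ‖u x‖ ^ 2 * (1 - ‖x‖ ^ 2) :=
      Real.sq_sqrt (le_of_lt hDx)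
    rw [← sq_eq_sq₀ (norm_nonneg _) zero_le_one, norm_add_sq_real, inner_smul_right, norm_smul,
      mul_pow, Real.norm_eq_abs, sq_abs]
    generalize √(D x) = d at *
    generalize ‖u x‖ ^ 2 = a at *
    field_simp
    linear_combination hsq
  · intro x hx
    have hx1 : ‖x‖ = 1 := by simpa using hx
    simp [D, hx1, Real.sqrt_sq (inner_pos x hx).le]

/-- **Brouwer fixed point theorem** for continuous maps of the closed unit ball into a smaller ball. -/
theorem exists_fixedPoint_closedBall_of_continuousOn {g : E → E} {ρ : ℝ} (hρ : ρ < 1)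
    (hg : ContinuousOn g (closedBall 0 1)) (hg1 : ∀ x ∈ closedBall (0 : E) 1, ‖g x‖ ≤ ρ) :
    ∃ x ∈ closedBall (0 : E) 1, g x = x := by
  by_contra! hne
  obtain ⟨x₀, hx₀, hmin⟩ := (isCompact_closedBall (0 : E) 1).exists_isMinOn
    ⟨0, by simp⟩ (hg.sub continuousOn_id).norm
  have hη : 0 < ‖g x₀ - x₀‖ := norm_pos_iff.2 (sub_ne_zero.2 (hne x₀ hx₀))
  have : TietzeExtension E := TietzeExtension.of_tvs ℝ
  obtain ⟨G, hG⟩ := ContinuousMap.exists_restrict_eq isClosed_closedBall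
    ⟨(closedBall (0 : E) 1).domRestrict g, hg.domRestrict⟩
  have hGg : ∀ x ∈ closedBall (0 : E) 1, G x = g x := fun x hx ↦
    congrArg (fun k : C(closedBall (0 : E) 1, E) ↦ k ⟨x, hx⟩) hG
  obtain ⟨p, hp, hpG, -⟩ := G.continuous.exists_contDiff_approx 1
    (ε := fun _ ↦ min ‖g x₀ - x₀‖ (1 - ρ)) continuous_const
    fun _ ↦ lt_min hη (sub_pos.2 hρ)
  have hpg : ∀ x ∈ closedBall (0 : E) 1, ‖p x - g x‖ < min ‖g x₀ - x₀‖ (1 - ρ) := fun x hx ↦ by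
    rw [← hGg x hx, ← dist_eq_norm]
    exact hpG x
  obtain ⟨x, hx, hpx⟩ := exists_fixedPoint_closedBall_of_contDiff hp fun x hx ↦ by
    have h1 := (hpg x hx).trans_le (min_le_right _ _)
    have h2 := norm_add_le (p x - g x) (g x)
    rw [sub_add_cancel] at h2
    linarith [hg1 x hx]
  have h1 := (hpg x hx).trans_le (min_le_left _ _)
  rw [hpx, norm_sub_rev] at h1
  exact h1.not_ge (hmin hx)

end FixedPoint

end

/-- A map of `ℝⁿ` that is continuous on the closed unit ball and
uniformly `ε`-close to the identity there (`ε < 1`) has image containing the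
open ball of radius `1 - ε`. -/
theorem image_of_closedBall_contains_ball_of_close_to_id {n : ℕ}
    (f : EuclideanSpace ℝ (Fin n) → EuclideanSpace ℝ (Fin n))
    (ε : ℝ) (hε0 : 0 ≤ ε) (hε1 : ε < 1)
    (hf : ContinuousOn f (Metric.closedBall (0 : EuclideanSpace ℝ (Fin n)) 1))
    (hclose : ∀ x ∈ Metric.closedBall (0 : EuclideanSpace ℝ (Fin n)) 1,
      ‖f x - x‖ ≤ ε) :
    Metric.ball (0 : EuclideanSpace ℝ (Fin n)) (1 - ε)
      ⊆ f '' Metric.closedBall (0 : EuclideanSpace ℝ (Fin n)) 1 := by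
  intro y hy
  obtain ⟨x, hx, hxy⟩ := exists_fixedPoint_closedBall_of_continuousOn
    (g := fun x ↦ y - (f x - x)) (ρ := ‖y‖ + ε)
    (by linarith [mem_ball_zero_iff.1 hy])
    (continuousOn_const.sub (hf.sub continuousOn_id))
    fun x hx ↦ (norm_sub_le _ _).trans (by gcongr; exact hclose x hx)
  refine ⟨x, hx, ?_⟩
  rw [sub_eq_iff_eq_add, add_sub_cancel] at hxy
  exact hxy.symm
end

section
/- Let X be a metric space, let ι be an index type, and let C, D : ι → Set X and δ : ι → ℝ satisfy: (i) the sets D i cover X; (ii) D i ⊆ interior(C i) for each i; (iii) δ i > 0 for each i; (iv) for each i, every point x ∈ D i and every point y with dist(y, x) < δ i satisfies y ∈ C i. Let f : X → X be a map that is injective on each set C i and satisfies dist(f(x), x) < δ i / 2 for every i and every x ∈ D i. Then f is injective on X. -/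
/-- Globalization of injectivity: a map that is injective on each
piece `C i` of a suitable cover and sufficiently `C⁰`-close to the identity on
the smaller pieces `D i` is globally injective. -/
theorem injective_of_locally_injective_close_to_id {X : Type} [MetricSpace X]
    {ι : Type} (C D : ι → Set X) (δ : ι → ℝ)
    (hcover : ∀ x : X, ∃ i, x ∈ D i)
    (hDC : ∀ i, D i ⊆ interior (C i))
    (hδ : ∀ i, 0 < δ i)
    (hdist : ∀ i, ∀ x ∈ D i, ∀ y : X, dist y x < δ i → y ∈ C i)
    (f : X → X)
    (hinj : ∀ i, Set.InjOn f (C i))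
    (hclose : ∀ i, ∀ x ∈ D i, dist (f x) x < δ i / 2) :
    Function.Injective f := by
  intro x y hxy
  obtain ⟨i, hi⟩ := hcover x
  obtain ⟨j, hj⟩ := hcover y
  wlog hij : δ j ≤ δ i generalizing x y i j
  · exact (this hxy.symm j hj i hi (le_of_not_ge hij)).symm
  have hx := hclose i x hi
  have hy := hclose j y hj
  have hyx : dist y x < δ i := by
    have h := dist_triangle_left y x (f y)
    rw [← hxy] at h hy
    linarith
  exact hinj i (interior_subset (hDC i hi)) (hdist i x hi y hyx) hxy
end

section
/- Let E = ℝⁿ, let c : ℝ → E be differentiable at t₀ with derivative c'(t₀), let p = c(t₀), and let γ : E → E be differentiable at p with γ(p) = p. Define the concatenated curve c̃ : ℝ → E by c̃(t) = c(t) for t ≤ t₀ and c̃(t) = γ(c(t)) for t > t₀. If c̃ is differentiable at t₀, then Dγ_p(c'(t₀)) = c'(t₀) (where Dγ_p is the Fréchet derivative of γ at p), and the derivative of c̃ at t₀ equals c'(t₀). -/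
/-- If the concatenation of a differentiable curve `c` with `γ ∘ c`
at `t₀` (where `γ` fixes `c t₀`) is differentiable at `t₀`, then the tangent
vector `c'(t₀)` is fixed by the derivative of `γ` at `c t₀`, and the
concatenated curve has the same derivative there. -/
theorem concatenated_lift_tangent_vector_fixed {n : ℕ}
    (c : ℝ → EuclideanSpace ℝ (Fin n)) (t₀ : ℝ)
    (v : EuclideanSpace ℝ (Fin n)) (hc : HasDerivAt c v t₀)
    (γ : EuclideanSpace ℝ (Fin n) → EuclideanSpace ℝ (Fin n))
    (hγ : DifferentiableAt ℝ γ (c t₀)) (hγfix : γ (c t₀) = c t₀)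
    (ctil : ℝ → EuclideanSpace ℝ (Fin n))
    (hctil : ∀ t : ℝ, ctil t = if t ≤ t₀ then c t else γ (c t))
    (hdiff : DifferentiableAt ℝ ctil t₀) :
    fderiv ℝ γ (c t₀) v = v ∧ deriv ctil t₀ = v := by
  have hleft : deriv ctil t₀ = v := by
    refine (uniqueDiffWithinAt_Iic t₀).eq_deriv _ hdiff.hasDerivAt.hasDerivWithinAt ?_
    exact hc.hasDerivWithinAt.congr (fun t ht => by rw [hctil, if_pos (Set.mem_Iic.mp ht)])
      (by rw [hctil, if_pos le_rfl])
  have hright : deriv ctil t₀ = fderiv ℝ γ (c t₀) v := by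
    refine (uniqueDiffWithinAt_Ioi t₀).eq_deriv _ hdiff.hasDerivAt.hasDerivWithinAt ?_
    exact (hγ.hasFDerivAt.comp_hasDerivAt t₀ hc).hasDerivWithinAt.congr
      (fun t ht => by rw [hctil, if_neg (not_le.mpr (Set.mem_Ioi.mp ht)), Function.comp_apply])
      (by rw [hctil, if_pos le_rfl, Function.comp_apply, hγfix])
  exact ⟨hright.symm.trans hleft, hleft⟩
end

section
/- Let E = ℝⁿ and let G be a finite group acting on E such that for every g ∈ G the map y ↦ g • y is C^∞. Let χ' : E → ℝ be a continuous G-invariant function (χ'(g • y) = χ'(y) for all g, y) and let ε > 0. Then there exists a C^∞ function χ : E → ℝ which is G-invariant (χ(g • y) = χ(y) for all g, y) and satisfies |χ(y) − χ'(y)| ≤ ε for all y ∈ E. -/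
open scoped Manifold ContDiff Topology

/-- A continuous real function on a finite-dimensional real normed space is uniformly
approximated by smooth functions. -/
theorem Continuous.exists_contDiff_abs_sub_le {E : Type*} [NormedAddCommGroup E]
    [NormedSpace ℝ E] [FiniteDimensional ℝ E] {f : E → ℝ} (hf : Continuous f)
    {ε : ℝ} (hε : 0 < ε) :
    ∃ g : E → ℝ, ContDiff ℝ ∞ g ∧ ∀ y, |g y - f y| ≤ ε := by
  obtain ⟨g, hg⟩ := exists_contMDiffMap_forall_mem_convex_of_local_const (n := ⊤) 𝓘(ℝ, E)
    (t := fun y => Metric.closedBall (f y) ε) (fun y => convex_closedBall (f y) ε)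
    (fun x => ⟨f x, by
      filter_upwards [hf.continuousAt.eventually (Metric.closedBall_mem_nhds (f x) hε)] with y hy
      exact Metric.mem_closedBall_comm.1 hy⟩)
  exact ⟨g, g.contMDiff.contDiff, fun y => hg y⟩

/-- The average of a real function over the orbits of a finite group. -/
noncomputable def orbitAverage (G : Type*) {X : Type*} [Group G] [Fintype G] [MulAction G X]
    (f : X → ℝ) (x : X) : ℝ :=
  (Fintype.card G : ℝ)⁻¹ * ∑ g : G, f (g • x)

section orbitAverage

variable {G X : Type*} [Group G] [Fintype G] [MulAction G X]

theorem orbitAverage_smul (f : X → ℝ) (g : G) (x : X) :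
    orbitAverage G f (g • x) = orbitAverage G f x := by
  simp only [orbitAverage, smul_smul]
  exact congrArg _ (Equiv.sum_comp (Equiv.mulRight g) fun h : G => f (h • x))

/-- Averaging does not increase the uniform distance to an invariant function. -/
theorem abs_orbitAverage_sub_le {f f₀ : X → ℝ} {ε : ℝ}
    (hinv : ∀ (g : G) (x : X), f₀ (g • x) = f₀ x) (h : ∀ x, |f x - f₀ x| ≤ ε) (x : X) :
    |orbitAverage G f x - f₀ x| ≤ ε := by
  have hcard : (0 : ℝ) < Fintype.card G := by exact_mod_cast Fintype.card_pos
  have heq : orbitAverage G f x - f₀ x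
      = (Fintype.card G : ℝ)⁻¹ * ∑ g : G, (f (g • x) - f₀ (g • x)) := by
    simp only [orbitAverage, hinv, Finset.sum_sub_distrib, Finset.sum_const, Finset.card_univ,
      nsmul_eq_mul]
    field_simp
  rw [heq, abs_mul, abs_of_pos (inv_pos.2 hcard), inv_mul_le_iff₀ hcard]
  calc |∑ g : G, (f (g • x) - f₀ (g • x))|
      ≤ ∑ g : G, |f (g • x) - f₀ (g • x)| := Finset.abs_sum_le_sum_abs _ _
    _ ≤ ∑ _g : G, ε := Finset.sum_le_sum fun g _ => h (g • x)
    _ = Fintype.card G * ε := by simp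

theorem ContDiff.orbitAverage {E : Type*} [NormedAddCommGroup E] [NormedSpace ℝ E]
    [MulAction G E] {k : ℕ∞ω} (hG : ∀ g : G, ContDiff ℝ k fun y : E => g • y)
    {f : E → ℝ} (hf : ContDiff ℝ k f) : ContDiff ℝ k (orbitAverage G f) :=
  contDiff_const.mul (ContDiff.sum fun g _ => hf.comp (hG g))

end orbitAverage


/-- Invariant smoothing: a continuous `G`-invariant function on `ℝⁿ`
(`G` a finite group acting smoothly) can be uniformly approximated by a smooth
`G`-invariant function. -/
theorem invariant_smooth_approximation {n : ℕ} {G : Type}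
    [Group G] [Fintype G] [MulAction G (EuclideanSpace ℝ (Fin n))]
    (hsmooth : ∀ g : G,
      ContDiff ℝ (⊤ : ℕ∞) (fun y : EuclideanSpace ℝ (Fin n) => g • y))
    (χ' : EuclideanSpace ℝ (Fin n) → ℝ) (hχ' : Continuous χ')
    (hinv : ∀ (g : G) (y : EuclideanSpace ℝ (Fin n)), χ' (g • y) = χ' y)
    (ε : ℝ) (hε : 0 < ε) :
    ∃ χ : EuclideanSpace ℝ (Fin n) → ℝ,
      ContDiff ℝ (⊤ : ℕ∞) χ ∧
      (∀ (g : G) (y : EuclideanSpace ℝ (Fin n)), χ (g • y) = χ y) ∧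
      (∀ y : EuclideanSpace ℝ (Fin n), |χ y - χ' y| ≤ ε) := by
  obtain ⟨f, hf, hfχ'⟩ := hχ'.exists_contDiff_abs_sub_le hε
  exact ⟨orbitAverage G f, hf.orbitAverage hsmooth, orbitAverage_smul f,
    abs_orbitAverage_sub_le hinv hfχ'⟩
end

section
/- Let X be a compact metric space which is a topological n-manifold without boundary (a charted space modeled on the Euclidean space ℝⁿ). Then there exists ε > 0 with the following property: for every index type ι and families C, D : ι → Set X and δ : ι → ℝ satisfying (i) the sets D i cover X, (ii) D i ⊆ interior(C i) for each i, (iii) δ i > 0 for each i, and (iv) for each i every x ∈ D i and every y with dist(y, x) < δ i satisfy y ∈ C i, every continuous map f : X → X that is injective on each C i and satisfies dist(f(x), x) < min(ε, δ i / 2) for every i and every x ∈ D i is a homeomorphism of X. -/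
open Metric Set MeasureTheory
open scoped NNReal

/-- Lagrange interpolation as a linear identity, with weights independent of the polynomial. -/
lemma Polynomial.exists_eval_eq_sum_eval {F : Type*} [Field F] (s : Finset F) (a : F) :
    ∃ c : F → F, ∀ p : Polynomial F, p.natDegree < s.card →
      p.eval a = ∑ t ∈ s, c t * p.eval t := by
  classical
  refine ⟨fun t => (Lagrange.basis s id t).eval a, fun p hp => ?_⟩
  have hdeg : p.degree < s.card :=
    Polynomial.degree_le_natDegree.trans_lt (by exact_mod_cast hp)
  conv_lhs => rw [Lagrange.eq_interpolate (v := id) (Set.injOn_id _) hdeg]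
  simp [Lagrange.interpolate_apply, Polynomial.eval_finsetSum, mul_comm]

section

variable {E : Type*} [NormedAddCommGroup E] [NormedSpace ℝ E]

/-- The determinant of `1 + t • A` is a polynomial in `t` of degree at most the dimension. -/
lemma ContinuousLinearMap.exists_polynomial_eval_eq_det_one_add_smul [FiniteDimensional ℝ E]
    (A : E →L[ℝ] E) : ∃ p : Polynomial ℝ, p.natDegree ≤ Module.finrank ℝ E ∧
      ∀ t : ℝ, p.eval t = (1 + t • A).det := by
  let b := Module.finBasis ℝ E
  let M := LinearMap.toMatrix b b (A : E →ₗ[ℝ] E)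
  refine ⟨_, (Polynomial.natDegree_det_X_add_C_le M 1).trans (by simp), fun t => ?_⟩
  rw [ContinuousLinearMap.det, ← LinearMap.det_toMatrix b, ← Polynomial.coe_evalRingHom,
    RingHom.map_det]
  congr 1
  ext i j
  obtain rfl | hij := eq_or_ne i j
  · simp [M, LinearMap.toMatrix_apply]
    ring
  · simp [M, LinearMap.toMatrix_apply, Matrix.one_apply_ne hij, hij.symm]
    ring

/-- Extending by zero a map that vanishes on a sphere does not worsen its Lipschitz constant on
the ball. -/
lemma LipschitzOnWith.lipschitzWith_indicator_closedBall {F : Type*} [NormedAddCommGroup F]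
    {u : E → F} {K : ℝ≥0} {R : ℝ} (hu : LipschitzOnWith K u (closedBall 0 R))
    (h0 : ∀ x ∈ sphere (0 : E) R, u x = 0) :
    LipschitzWith K ((closedBall (0 : E) R).indicator u) := by
  have key : ∀ x ∈ closedBall (0 : E) R, ∀ y ∉ closedBall (0 : E) R,
      dist (u x) 0 ≤ K * dist x y := by
    intro x hx y hy
    rw [mem_closedBall_zero_iff] at hx hy
    obtain ⟨z, hz, hzR⟩ := (convex_segment x y).isPreconnected.intermediate_value
      (left_mem_segment ℝ x y) (right_mem_segment ℝ x y) continuous_norm.continuousOn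
      ⟨hx, (not_le.1 hy).le⟩
    have hxz : dist x z ≤ dist x y := by
      rw [← dist_add_dist_of_mem_segment hz]
      exact le_add_of_nonneg_right dist_nonneg
    rw [← h0 z (by simpa using hzR)]
    exact (hu.dist_le_mul x (by simpa using hx) z (by simpa using hzR.le)).trans (by gcongr)
  refine LipschitzWith.of_dist_le_mul fun x y => ?_
  by_cases hx : x ∈ closedBall (0 : E) R <;> by_cases hy : y ∈ closedBall (0 : E) R
  · simpa only [indicator_of_mem hx, indicator_of_mem hy] using hu.dist_le_mul x hx y hy
  · simpa only [indicator_of_mem hx, indicator_of_notMem hy] using key x hx y hy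
  · rw [indicator_of_notMem hx, indicator_of_mem hy, dist_comm, dist_comm x]
    exact key y hy x hx
  · rw [indicator_of_notMem hx, indicator_of_notMem hy, dist_self]
    positivity

/-- A small Lipschitz perturbation of the identity of a Banach space is bijective. -/
lemma LipschitzWith.bijective_id_add [CompleteSpace E] {w : E → E} {K : ℝ≥0}
    (hw : LipschitzWith K w) (hK : K < 1) : Function.Bijective fun x => x + w x := by
  have happ : ApproximatesLinearOn (fun x => x + w x)
      ((ContinuousLinearEquiv.refl ℝ E : E ≃L[ℝ] E) : E →L[ℝ] E) univ K := by
    intro x _ y _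
    simpa [add_sub_add_comm] using hw.norm_sub_le x y
  have hc : Subsingleton E ∨
      K < ‖((ContinuousLinearEquiv.refl ℝ E).symm : E →L[ℝ] E)‖₊⁻¹ := by
    rcases subsingleton_or_nontrivial E with h | h
    · exact Or.inl h
    · right
      have : ‖((ContinuousLinearEquiv.refl ℝ E).symm : E →L[ℝ] E)‖₊ = 1 := by
        simp
      rwa [this, inv_one]
  exact ⟨injOn_univ.1 (happ.injOn hc), happ.surjective hc⟩

lemma Function.Bijective.image_eq_of_forall_notMem {α : Type*} {F : α → α} {s : Set α}
    (hF : Function.Bijective F) (h : ∀ x ∉ s, F x = x) : F '' s = s := by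
  refine Subset.antisymm ?_ fun y hy => ?_
  · rintro _ ⟨x, hx, rfl⟩
    by_contra hFx
    exact hFx ((hF.1 (h _ hFx)).symm ▸ hx)
  · obtain ⟨x, rfl⟩ := hF.2 y
    by_cases hx : x ∈ s
    · exact mem_image_of_mem F hx
    · exact absurd (h x hx ▸ hy) hx

variable [FiniteDimensional ℝ E] [MeasurableSpace E] [BorelSpace E]

lemma setIntegral_det_one_add_smul_fderiv_s14 {μ : Measure E} [μ.IsAddHaarMeasure] {u : E → E} {R : ℝ}
    {K : ℝ≥0} (hu : Differentiable ℝ u) (hK : LipschitzOnWith K u (closedBall 0 R))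
    (h0 : ∀ x ∈ sphere (0 : E) R, u x = 0) {t : ℝ≥0} (ht : t * K < 1)
    (hdet : ∀ x ∈ ball (0 : E) R, 0 ≤ (1 + (t : ℝ) • fderiv ℝ u x).det) :
    ∫ x in ball (0 : E) R, (1 + (t : ℝ) • fderiv ℝ u x).det ∂μ = μ.real (ball 0 R) := by
  let w := (closedBall (0 : E) R).indicator u
  have hw : LipschitzWith (t * K) fun x => (t : ℝ) • w x := by
    refine LipschitzWith.of_dist_le_mul fun x y => ?_
    have := (hK.lipschitzWith_indicator_closedBall h0).dist_le_mul x y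
    rw [dist_smul₀, NNReal.coe_mul, mul_assoc]
    simpa using mul_le_mul_of_nonneg_left this t.2
  have hbij := hw.bijective_id_add ht
  have himage : (fun x => x + (t : ℝ) • w x) '' ball 0 R = ball 0 R := by
    refine hbij.image_eq_of_forall_notMem fun x hx => ?_
    have : w x = 0 := by
      by_cases hx' : x ∈ closedBall (0 : E) R
      · simp only [w, indicator_of_mem hx']
        exact h0 x (by simp at hx hx' ⊢; exact le_antisymm hx' hx)
      · exact indicator_of_notMem hx' u
    simp [this]
  have hderiv : ∀ x ∈ ball (0 : E) R, HasFDerivWithinAt (fun x => x + (t : ℝ) • w x)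
      (1 + (t : ℝ) • fderiv ℝ u x) (ball 0 R) x := by
    intro x hx
    have h1 : HasFDerivAt (fun x => x + (t : ℝ) • u x) (1 + (t : ℝ) • fderiv ℝ u x) x :=
      (hasFDerivAt_id x).add ((hu x).hasFDerivAt.const_smul (t : ℝ))
    refine h1.hasFDerivWithinAt.congr' (fun y hy => ?_) hx
    simp only [w, indicator_of_mem (ball_subset_closedBall hy)]
  have := integral_image_eq_integral_abs_det_fderiv_smul μ measurableSet_ball hderiv
    hbij.1.injOn (fun _ => (1 : ℝ))
  rw [himage] at this
  simp only [smul_eq_mul, mul_one, integral_const, MeasurableSet.univ, measureReal_restrict_apply,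
    univ_inter] at this
  rw [this]
  exact setIntegral_congr_fun measurableSet_ball fun x hx => (abs_of_nonneg (hdet x hx)).symm

/-- The signed volume of the image of a ball under a `C¹` map depends only on the values of the
map on the boundary sphere. -/
lemma setIntegral_det_one_add_fderiv {μ : Measure E} [μ.IsAddHaarMeasure] {u : E → E} {R : ℝ}
    (hu : ContDiff ℝ 1 u) (h0 : ∀ x ∈ sphere (0 : E) R, u x = 0) :
    ∫ x in ball (0 : E) R, (1 + fderiv ℝ u x).det ∂μ = μ.real (ball 0 R) := by
  have hd : Differentiable ℝ u := hu.differentiable one_ne_zero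
  have hcont : Continuous (fderiv ℝ u) := hu.continuous_fderiv one_ne_zero
  obtain ⟨K, hK⟩ := (isCompact_closedBall (0 : E) R).exists_bound_of_continuousOn
    hcont.continuousOn
  have hKlip : LipschitzOnWith K.toNNReal u (closedBall 0 R) :=
    (convex_closedBall 0 R).lipschitzOnWith_of_nnnorm_fderiv_le (fun x _ => hd x)
      fun x hx => by
        rw [← NNReal.coe_le_coe, coe_nnnorm]
        exact (hK x hx).trans (Real.le_coe_toNNReal K)
  obtain ⟨η, hη, hηdet⟩ : ∃ η > 0, ∀ B : E →L[ℝ] E, ‖B‖ < η → 0 ≤ (1 + B).det := by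
    have hc : ContinuousAt (fun B : E →L[ℝ] E => (1 + B).det) 0 :=
      (ContinuousLinearMap.continuous_det.comp (continuous_const.add continuous_id)).continuousAt
    have h1 : (0 : ℝ) < (1 + (0 : E →L[ℝ] E)).det := by
      simp [ContinuousLinearMap.det]
    obtain ⟨η, hη, h⟩ := Metric.eventually_nhds_iff.1 (hc.eventually_const_lt h1)
    exact ⟨η, hη, fun B hB => (h (by simpa using hB)).le⟩
  obtain ⟨τ, hτ, hτK⟩ : ∃ τ > 0, ∀ t : ℝ, 0 < t → t < τ → t * K.toNNReal < min 1 η := by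
    have hm : 0 < min 1 η := lt_min one_pos hη
    refine ⟨min 1 η / (K.toNNReal + 1), by positivity, fun t ht h => ?_⟩
    rw [lt_div_iff₀ (by positivity)] at h
    linarith
  obtain ⟨s, hs, hcard⟩ := (Ioo_infinite hτ).exists_subset_card_eq (Module.finrank ℝ E + 1)
  obtain ⟨c, hc⟩ := Polynomial.exists_eval_eq_sum_eval s (1 : ℝ)
  have hnode : ∀ t ∈ s, ∫ x in ball (0 : E) R, (1 + t • fderiv ℝ u x).det ∂μ
      = μ.real (ball 0 R) := by
    intro t ht
    obtain ⟨ht0, htτ⟩ := hs ht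
    have hlt := hτK t ht0 htτ
    lift t to ℝ≥0 using ht0.le
    refine setIntegral_det_one_add_smul_fderiv_s14 hd hKlip h0 ?_ fun x hx => hηdet _ ?_
    · exact_mod_cast hlt.trans_le (min_le_left _ _)
    · rw [norm_smul, Real.norm_of_nonneg t.coe_nonneg]
      refine lt_of_le_of_lt ?_ (hlt.trans_le (min_le_right _ _))
      gcongr
      exact (hK x (ball_subset_closedBall hx)).trans (Real.le_coe_toNNReal K)
  have hint : ∀ t : ℝ, IntegrableOn (fun x => (1 + t • fderiv ℝ u x).det) (ball 0 R) μ :=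
    fun t => ((ContinuousLinearMap.continuous_det.comp
      (continuous_const.add (hcont.const_smul t))).continuousOn.integrableOn_compact
      (isCompact_closedBall (0 : E) R)).mono_set ball_subset_closedBall
  have hsum : ∑ t ∈ s, c t = 1 := by
    simpa using (hc 1 (by simp [hcard])).symm
  calc ∫ x in ball (0 : E) R, (1 + fderiv ℝ u x).det ∂μ
      = ∫ x in ball (0 : E) R, ∑ t ∈ s, c t * (1 + t • fderiv ℝ u x).det ∂μ := by
        congr 1 with x
        obtain ⟨p, hp, hpe⟩ :=
          (fderiv ℝ u x).exists_polynomial_eval_eq_det_one_add_smul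
        simpa [hpe] using hc p (by omega)
    _ = ∑ t ∈ s, c t * μ.real (ball 0 R) := by
        rw [integral_finsetSum _ fun t _ => (hint t).const_mul (c t)]
        exact Finset.sum_congr rfl fun t ht => by rw [integral_const_mul, hnode t ht]
    _ = μ.real (ball 0 R) := by rw [← Finset.sum_mul, hsum, one_mul]

end

section

variable {E : Type*} [NormedAddCommGroup E] [InnerProductSpace ℝ E] [FiniteDimensional ℝ E]

/-- If a differentiable map takes values in a sphere, its derivative is singular. -/
lemma det_fderiv_eq_zero_of_norm_eq {G : E → E} {R : ℝ} (hR : 0 < R) (hG : Differentiable ℝ G)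
    (hnorm : ∀ x, ‖G x‖ = R) (x : E) : (fderiv ℝ G x).det = 0 := by
  by_contra hdet
  obtain ⟨v, hv⟩ := ((fderiv ℝ G x).toContinuousLinearEquivOfDetNeZero hdet).surjective (G x)
  have hv' : fderiv ℝ G x v = G x := hv
  have h1 := ((hG x).hasFDerivAt.norm_sq)
  simp only [hnorm] at h1
  have h2 := DFunLike.congr_fun (h1.unique (hasFDerivAt_const _ x)) v
  simp [hv', hnorm, hR.ne'] at h2

/-- There is no `C¹` retraction onto a sphere. -/
lemma not_contDiff_retraction_sphere {G : E → E} {R : ℝ} (hR : 0 < R) (hG : ContDiff ℝ 1 G)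
    (hnorm : ∀ x, ‖G x‖ = R) : ¬ ∀ x ∈ sphere (0 : E) R, G x = x := by
  intro hid
  borelize E
  have hd : Differentiable ℝ G := hG.differentiable one_ne_zero
  have hvol := setIntegral_det_one_add_fderiv (μ := (Measure.addHaar : Measure E))
    (hG.sub contDiff_id) fun x hx => sub_eq_zero.2 (hid x hx)
  have hzero : ∀ x, (1 + fderiv ℝ (fun x => G x - id x) x).det = 0 := by
    intro x
    rw [← det_fderiv_eq_zero_of_norm_eq hR hd hnorm x, fderiv_fun_sub (hd x) differentiableAt_id,
      fderiv_id]
    congr 1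
    ext v
    simp
  simp only [hzero, integral_zero] at hvol
  exact (ENNReal.toReal_pos (measure_ball_pos _ (0 : E) hR).ne' measure_ball_lt_top.ne).ne hvol

lemma exists_add_eq_zero_of_hasCompactSupport {u : E → E} (hu : Continuous u)
    (hc : HasCompactSupport u) : ∃ x, x + u x = 0 := by
  by_contra! hne
  obtain ⟨v, hv, hvu, hsupp⟩ := hu.exists_contDiff_approx 1 (ε := fun x => ‖x + u x‖)
    (by fun_prop) fun x => norm_pos_iff.2 (hne x)
  have hne' : ∀ x, x + v x ≠ 0 := by
    intro x hx
    have := hvu x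
    rw [dist_eq_norm, eq_neg_of_add_eq_zero_right hx, ← norm_neg] at this
    simp [add_comm] at this
  obtain ⟨R, hR, hball⟩ := hc.isBounded.subset_ball_lt 0 0
  have hv0 : ∀ x ∈ sphere (0 : E) R, v x = 0 := by
    intro x hx
    by_contra h
    have := hball (subset_tsupport u (hsupp h))
    simp at hx this
    linarith
  refine not_contDiff_retraction_sphere (G := fun x => (R / ‖x + v x‖) • (x + v x)) hR ?_ ?_ ?_
  · have hadd : ContDiff ℝ 1 fun x => x + v x := contDiff_id.add hv
    exact (contDiff_const.div (hadd.norm ℝ hne') fun x => norm_ne_zero_iff.2 (hne' x)).smul hadd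
  · intro x
    have := norm_ne_zero_iff.2 (hne' x)
    rw [norm_smul, norm_div, norm_norm, Real.norm_of_nonneg hR.le, div_mul_cancel₀ _ this]
  · intro x hx
    rw [mem_sphere_zero_iff_norm] at hx
    simp [hv0 x (by simpa using hx), hx, hR.ne']

/-- A compactly supported continuous perturbation of the identity of a Euclidean space is
surjective. -/
theorem surjective_id_add_of_hasCompactSupport {u : E → E} (hu : Continuous u)
    (hc : HasCompactSupport u) : Function.Surjective fun x => x + u x := by
  intro y
  obtain ⟨x, hx⟩ := exists_add_eq_zero_of_hasCompactSupport
    (hu.comp (continuous_add_const y)) (hc.comp_homeomorph (Homeomorph.addRight y))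
  refine ⟨x + y, ?_⟩
  have : x + u (x + y) = 0 := hx
  calc x + y + u (x + y) = (x + u (x + y)) + y := by abel
    _ = y := by rw [this, zero_add]

/-- A continuous map on a closed ball that moves points by less than a quarter of the radius covers
the concentric open ball of a quarter of the radius. -/
theorem exists_mem_closedBall_eq_of_dist_lt {g : E → E} {c y : E} {r : ℝ} (hr : 0 < r)
    (hg : ContinuousOn g (closedBall c r)) (hclose : ∀ x ∈ closedBall c r, dist (g x) x < r / 4)
    (hy : y ∈ ball c (r / 4)) : ∃ x ∈ closedBall c r, g x = y := by
  let χ : ContDiffBump c := ⟨r / 2, 3 * r / 4, by positivity, by linarith⟩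
  let u : E → E := fun x => χ x • (g x - x)
  have hu : Continuous u := by
    refine continuous_of_tsupport fun x hx => ?_
    have hx' := tsupport_smul_subset_left _ _ hx
    rw [χ.tsupport_eq, mem_closedBall] at hx'
    have hgx : ContinuousAt g x := hg.continuousAt <|
      closedBall_mem_nhds_of_mem (lt_of_le_of_lt hx' (by change 3 * r / 4 < r; linarith))
    exact χ.continuous.continuousAt.smul (hgx.sub continuousAt_id)
  have huc : HasCompactSupport u := χ.hasCompactSupport.smul_right
  obtain ⟨x, hx : x + χ x • (g x - x) = y⟩ := surjective_id_add_of_hasCompactSupport hu huc y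
  have hxc : x ∈ closedBall c r := by
    by_contra hxc
    have hχ : χ x = 0 := χ.zero_of_le_dist (by
      rw [mem_closedBall, not_le] at hxc
      change 3 * r / 4 ≤ dist x c
      linarith)
    rw [hχ, zero_smul, add_zero] at hx
    exact hxc (ball_subset_closedBall (ball_subset_ball (by linarith) (hx ▸ hy)))
  have hxy : dist y x ≤ r / 4 := by
    rw [← hx, dist_eq_norm, add_sub_cancel_left, norm_smul, Real.norm_of_nonneg χ.nonneg,
      ← dist_eq_norm]
    exact (mul_le_of_le_one_left dist_nonneg χ.le_one).trans (hclose x hxc).le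
  have hχ : χ x = 1 := χ.one_of_mem_closedBall (by
    have := dist_triangle_left x c y
    rw [mem_ball] at hy
    change dist x c ≤ r / 2
    linarith)
  exact ⟨x, hxc, by simpa [hχ] using hx⟩

/-- On a compact metric topological manifold, every continuous map sufficiently `C⁰`-close to the
identity is surjective. -/
theorem exists_pos_forall_surjective_of_dist_lt (E : Type*) [NormedAddCommGroup E]
    [InnerProductSpace ℝ E] [FiniteDimensional ℝ E] (X : Type*) [MetricSpace X] [CompactSpace X]
    [ChartedSpace E X] :
    ∃ ε > (0 : ℝ), ∀ f : X → X, Continuous f → (∀ x, dist (f x) x < ε) →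
      Function.Surjective f := by
  suffices h : ∃ ε > (0 : ℝ), ∀ f : X → X, Continuous f → (∀ x, dist (f x) x < ε) →
      univ ⊆ range f by simpa only [univ_subset_iff, range_eq_univ] using h
  refine isCompact_univ.induction_on (p := fun s : Set X => ∃ ε > (0 : ℝ), ∀ f : X → X,
    Continuous f → (∀ x, dist (f x) x < ε) → s ⊆ range f) ?_ ?_ ?_ ?_
  · exact ⟨1, one_pos, fun f _ _ => empty_subset _⟩
  · rintro s t hst ⟨ε, hε, h⟩
    exact ⟨ε, hε, fun f hf hd => hst.trans (h f hf hd)⟩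
  · rintro s t ⟨ε, hε, h⟩ ⟨ε', hε', h'⟩
    refine ⟨min ε ε', lt_min hε hε', fun f hf hd => union_subset ?_ ?_⟩
    · exact h f hf fun x => (hd x).trans_le (min_le_left _ _)
    · exact h' f hf fun x => (hd x).trans_le (min_le_right _ _)
  intro p _
  let e := chartAt E p
  obtain ⟨r, hr, hrt⟩ := nhds_basis_closedBall.mem_iff.1
    (e.open_target.mem_nhds (mem_chart_target E p))
  let K : Set X := e.symm '' closedBall (e p) r
  have hK : IsCompact K :=
    (isCompact_closedBall _ _).image_of_continuousOn (e.continuousOn_symm.mono hrt)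
  have hKs : K ⊆ e.source := by
    rintro _ ⟨x, hx, rfl⟩
    exact e.map_target (hrt hx)
  obtain ⟨ε₁, hε₁, h₁⟩ := hK.exists_thickening_subset_open e.open_source hKs
  obtain ⟨ε₂, hε₂, h₂⟩ := Metric.mem_uniformity_dist.1
    (hK.uniformContinuousAt_of_continuousAt e (fun x hx => e.continuousAt (hKs hx))
      (Metric.dist_mem_uniformity (show 0 < r / 4 by positivity)))
  refine ⟨e.source ∩ e ⁻¹' ball (e p) (r / 4), mem_nhdsWithin_of_mem_nhds <|
    (e.continuousOn.isOpen_inter_preimage e.open_source isOpen_ball).mem_nhds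
      ⟨mem_chart_source E p, mem_ball_self (by positivity)⟩,
    min ε₁ ε₂, lt_min hε₁ hε₂, ?_⟩
  rintro f hf hd y ⟨hys, hy⟩
  have hfs : ∀ x ∈ K, f x ∈ e.source := fun x hx =>
    h₁ (mem_thickening_iff.2 ⟨x, hx, (hd x).trans_le (min_le_left _ _)⟩)
  obtain ⟨x, hx, hxy⟩ := exists_mem_closedBall_eq_of_dist_lt (g := fun x => e (f (e.symm x))) hr
    (e.continuousOn.comp (hf.comp_continuousOn (e.continuousOn_symm.mono hrt))
      fun x hx => hfs _ (mem_image_of_mem _ hx))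
    (fun x hx => by
      have := h₂ (a := e.symm x) (b := f (e.symm x))
        (by rw [dist_comm]; exact (hd _).trans_le (min_le_right _ _)) (mem_image_of_mem _ hx)
      rw [mem_ofPred_eq] at this
      simpa only [e.right_inv (hrt hx), dist_comm] using this) hy
  exact ⟨e.symm x, e.injOn (hfs _ (mem_image_of_mem _ hx)) hys hxy⟩

end

/-- A map that moves points less than half of the local injectivity radius is injective. -/
lemma injective_of_injOn_cover_of_dist_lt {X ι : Type*} [PseudoMetricSpace X] {C D : ι → Set X}
    {δ : ι → ℝ} (hD : ∀ x, ∃ i, x ∈ D i)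
    (hC : ∀ i, ∀ x ∈ D i, ∀ y, dist y x < δ i → y ∈ C i) {f : X → X}
    (hinj : ∀ i, InjOn f (C i)) (hf : ∀ i, ∀ x ∈ D i, dist (f x) x < δ i / 2) :
    Function.Injective f := by
  intro x y hxy
  obtain ⟨i, hi⟩ := hD x
  obtain ⟨j, hj⟩ := hD y
  have hx := hf i x hi
  have hy := hf j y hj
  have hdist : dist x y < δ i / 2 + δ j / 2 := by
    have := dist_triangle_left x y (f x)
    rw [← hxy] at hy
    linarith
  have hx0 : 0 ≤ dist (f x) x := dist_nonneg
  have hy0 : 0 ≤ dist (f y) y := dist_nonneg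
  rcases le_total (δ i) (δ j) with hij | hij
  · exact hinj j (hC j y hj x (by linarith)) (hC j y hj y (by rw [dist_self]; linarith)) hxy
  · exact hinj i (hC i x hi x (by rw [dist_self]; linarith))
      (hC i x hi y (by rw [dist_comm]; linarith)) hxy

/-- On a compact metric topological `n`-manifold (without boundary),
there is `ε > 0` such that every continuous map injective on the pieces of a
suitable cover and `C⁰`-`min ε (δ i / 2)`-close to the identity is a
homeomorphism. -/
theorem close_to_id_locally_injective_is_homeomorph {n : ℕ} {X : Type}
    [MetricSpace X] [CompactSpace X]
    [ChartedSpace (EuclideanSpace ℝ (Fin n)) X] :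
    ∃ ε > (0 : ℝ), ∀ (ι : Type) (C D : ι → Set X) (δ : ι → ℝ),
      (∀ x : X, ∃ i, x ∈ D i) →
      (∀ i, D i ⊆ interior (C i)) →
      (∀ i, 0 < δ i) →
      (∀ i, ∀ x ∈ D i, ∀ y : X, dist y x < δ i → y ∈ C i) →
      ∀ f : X → X, Continuous f →
        (∀ i, Set.InjOn f (C i)) →
        (∀ i, ∀ x ∈ D i, dist (f x) x < min ε (δ i / 2)) →
        IsHomeomorph f := by
  obtain ⟨ε, hε, hsurj⟩ :=
    exists_pos_forall_surjective_of_dist_lt (EuclideanSpace ℝ (Fin n)) X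
  refine ⟨ε, hε, fun ι C D δ hD _ _ hC f hf hinj hclose => ?_⟩
  rw [isHomeomorph_iff_continuous_bijective]
  refine ⟨hf, ?_, hsurj f hf fun x => ?_⟩
  · exact injective_of_injOn_cover_of_dist_lt hD hC hinj fun i x hx =>
      (hclose i x hx).trans_le (min_le_right _ _)
  · obtain ⟨i, hi⟩ := hD x
    exact (hclose i x hi).trans_le (min_le_left _ _)
end
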